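/- arXiv:2507.08503 — 3 statements merged into one kernel-verified Lean document; each statement's English description precedes it below -/
import Mathlib

section
/- For every integer n ≥ 6, the Staller-start game isolation number of the cycle satisfies the lower bound min{2·⌈(n−3)/5⌉, 2·⌈(n−4)/5⌉ + 1} ≤ ι_g'(C_n). -/
open SimpleGraph

variable {V : Type*}

/-- The closed neighborhood `N_G[X]` of a set `X` of vertices: all vertices that are in `X`
or adjacent to a vertex of `X`. -/
def closedNbhdSet (G : SimpleGraph V) (X : Set V) : Set V :=
  {u | u ∈ X ∨ ∃ x ∈ X, G.Adj x u}

/-- A vertex `v` is playable with respect to the set `X` of already selected vertices if the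
closed neighborhood of `v` contains a vertex `u ∉ N_G[X]` having a neighbor `w ∉ N_G[X]`,
i.e. `v` dominates a vertex of a nontrivial component of `G - N_G[X]`. -/
def IsPlayable (G : SimpleGraph V) (X : Set V) (v : V) : Prop :=
  ∃ u, (u = v ∨ G.Adj v u) ∧ u ∉ closedNbhdSet G X ∧
    ∃ w, G.Adj u w ∧ w ∉ closedNbhdSet G X

open Classical in
/-- The optimal-play value (number of further selected vertices) of the isolation game
position with given fuel, player to move (`true` = Dominator, the minimizer;
`false` = Staller, the maximizer) and set `X` of already selected vertices. -/
noncomputable def isoGameVal (G : SimpleGraph V) : ℕ → Bool → Set V → ℕ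
  | 0, _, _ => 0
  | (k + 1), isDom, X =>
    if ∃ v, IsPlayable G X v then
      (if isDom then sInf else sSup)
        {n : ℕ | ∃ v, IsPlayable G X v ∧ n = isoGameVal G k (!isDom) (insert v X) + 1}
    else 0

/-- The game isolation number `ι_g(G)`: the number of vertices selected in the isolation
game on `G` when Dominator moves first and both players play optimally.  (A game on a
graph with `n` vertices lasts at most `n` moves, so fuel `Fintype.card V` suffices.) -/
noncomputable def iotaGame (G : SimpleGraph V) [Fintype V] : ℕ :=
  isoGameVal G (Fintype.card V) true ∅

/-- The Staller-start game isolation number `ι_g'(G)`: the number of vertices selected in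
the isolation game on `G` when Staller moves first and both players play optimally. -/
noncomputable def iotaGame' (G : SimpleGraph V) [Fintype V] : ℕ :=
  isoGameVal G (Fintype.card V) false ∅

/-- Closed neighborhoods of sets in a cycle, described by addition. -/
theorem mem_closedNbhdSet_cycleGraph {m : ℕ} {X : Set (Fin (m + 2))} {u : Fin (m + 2)} :
    u ∈ closedNbhdSet (cycleGraph (m + 2)) X ↔ u ∈ X ∨ u - 1 ∈ X ∨ u + 1 ∈ X := by
  simp only [closedNbhdSet, Set.mem_ofPred_eq, cycleGraph_adj]
  refine or_congr_right ⟨?_, ?_⟩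
  · rintro ⟨x, hx, h | h⟩
    · right; rwa [← h, add_sub_cancel]
    · left; rwa [← h, sub_sub_cancel]
  · rintro (h | h)
    · exact ⟨_, h, Or.inr (sub_sub_cancel _ _)⟩
    · exact ⟨_, h, Or.inl (add_sub_cancel_left _ _)⟩

theorem closedNbhdSet_mono (G : SimpleGraph V) {X Y : Set V} (h : X ⊆ Y) :
    closedNbhdSet G X ⊆ closedNbhdSet G Y := by
  rintro u (hu | ⟨x, hx, hxu⟩)
  exacts [Or.inl (h hu), Or.inr ⟨x, h hx, hxu⟩]

open Classical in
/-- The edges `{i, i + 1}` of the cycle, indexed by `i`, both of whose ends are undominated. -/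
noncomputable def undominatedEdges {m : ℕ} (X : Set (Fin (m + 2))) : Finset (Fin (m + 2)) :=
  {i | i ∉ closedNbhdSet (cycleGraph (m + 2)) X ∧ i + 1 ∉ closedNbhdSet (cycleGraph (m + 2)) X}

theorem mem_undominatedEdges {m : ℕ} {X : Set (Fin (m + 2))} {i : Fin (m + 2)} :
    i ∈ undominatedEdges X ↔ i ∉ closedNbhdSet (cycleGraph (m + 2)) X ∧
      i + 1 ∉ closedNbhdSet (cycleGraph (m + 2)) X := by
  simp [undominatedEdges]

/-- Every move destroys at most four undominated edges. -/
theorem card_undominatedEdges_le_insert_add_four {m : ℕ} (X : Set (Fin (m + 2)))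
    (v : Fin (m + 2)) :
    (undominatedEdges X).card ≤ (undominatedEdges (insert v X)).card + 4 := by
  have hsub : undominatedEdges X ⊆
      undominatedEdges (insert v X) ∪ {v - 1 - 1, v - 1, v, v + 1} := by
    intro i hi
    simp only [Finset.mem_union, mem_undominatedEdges, mem_closedNbhdSet_cycleGraph,
      Set.mem_insert_iff, Finset.mem_insert, Finset.mem_singleton] at hi ⊢
    have h₁ : i + 1 = v → i = v - 1 := eq_sub_of_add_eq
    have h₂ : i + 1 + 1 = v → i = v - 1 - 1 := fun h => eq_sub_of_add_eq (eq_sub_of_add_eq h)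
    have h₃ : i - 1 = v → i = v + 1 := eq_add_of_sub_eq
    have h₄ : i + 1 - 1 = i := add_sub_cancel_right _ _
    rw [h₄] at hi ⊢
    tauto
  calc _ ≤ _ := Finset.card_le_card hsub
    _ ≤ _ := Finset.card_union_le _ _
    _ ≤ _ := Nat.add_le_add_left Finset.card_le_four _

/-- Every playable move destroys an undominated edge. -/
theorem card_undominatedEdges_insert_lt {m : ℕ} {X : Set (Fin (m + 2))} {v : Fin (m + 2)}
    (hv : IsPlayable (cycleGraph (m + 2)) X v) :
    (undominatedEdges (insert v X)).card < (undominatedEdges X).card := by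
  have hmono := closedNbhdSet_mono (cycleGraph (m + 2)) (Set.subset_insert v X)
  have hsub : undominatedEdges (insert v X) ⊆ undominatedEdges X := by
    intro i
    simp only [mem_undominatedEdges]
    exact fun h => ⟨fun h' => h.1 (hmono h'), fun h' => h.2 (hmono h')⟩
  obtain ⟨u, huv, hu, w, huw, hw⟩ := hv
  have hu' : u ∈ closedNbhdSet (cycleGraph (m + 2)) (insert v X) := by
    rcases huv with rfl | h
    exacts [Or.inl (Set.mem_insert _ _), Or.inr ⟨v, Set.mem_insert _ _, h⟩]
  refine Finset.card_lt_card ((Finset.ssubset_iff_of_subset hsub).2 ?_)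
  rcases cycleGraph_adj.1 huw with h | h
  · obtain rfl := eq_add_of_sub_eq' h
    exact ⟨w, mem_undominatedEdges.2 ⟨hw, hu⟩, fun h' => (mem_undominatedEdges.1 h').2 hu'⟩
  · obtain rfl := eq_add_of_sub_eq' h
    exact ⟨u, mem_undominatedEdges.2 ⟨hu, hw⟩, fun h' => (mem_undominatedEdges.1 h').1 hu'⟩

theorem exists_isPlayable_of_mem_undominatedEdges {m : ℕ} {X : Set (Fin (m + 2))}
    {i : Fin (m + 2)} (hi : i ∈ undominatedEdges X) :
    ∃ v, IsPlayable (cycleGraph (m + 2)) X v := by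
  obtain ⟨h₀, h₁⟩ := mem_undominatedEdges.1 hi
  exact ⟨i, i, Or.inl rfl, h₀, i + 1, cycleGraph_adj.2 (Or.inr (add_sub_cancel_left _ _)), h₁⟩

/-- A subset of `Fin (m + 1)` closed under subtracting one is empty or everything. -/
theorem Fin.forall_of_forall_sub_one {m : ℕ} {p : Fin (m + 1) → Prop} {i : Fin (m + 1)}
    (hi : p i) (hp : ∀ j, p j → p (j - 1)) (j : Fin (m + 1)) : p j := by
  induction h : (i - j).val generalizing j with
  | zero =>
    obtain rfl : i = j := sub_eq_zero.1 (Fin.ext h)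
    exact hi
  | succ k ih =>
    have hne : i - j ≠ 0 := by
      intro h₀
      simp [h₀] at h
    have hprev := ih (j + 1) (by rw [← sub_sub, Fin.val_sub_one_of_ne_zero hne, h]; rfl)
    simpa using hp _ hprev

/-- Once the game has begun and is not over, some move destroys at most one undominated edge:
select the dominated vertex next to an end of a run of undominated vertices. -/
theorem exists_isPlayable_card_undominatedEdges_le {m : ℕ} {X : Set (Fin (m + 2))}
    (hX : X.Nonempty) (hE : (undominatedEdges X).Nonempty) :
    ∃ v, IsPlayable (cycleGraph (m + 2)) X v ∧
      (undominatedEdges X).card ≤ (undominatedEdges (insert v X)).card + 1 := by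
  obtain ⟨i, hi, hi'⟩ : ∃ i ∈ undominatedEdges X,
      i - 1 ∈ closedNbhdSet (cycleGraph (m + 2)) X := by
    by_contra! hcon
    obtain ⟨i, hi⟩ := hE
    obtain ⟨x, hx⟩ := hX
    have hall := Fin.forall_of_forall_sub_one (p := (· ∈ undominatedEdges X)) hi
      fun j hj => mem_undominatedEdges.2
        ⟨hcon j hj, by rw [sub_add_cancel]; exact (mem_undominatedEdges.1 hj).1⟩
    exact (mem_undominatedEdges.1 (hall x)).1 (Or.inl hx)
  obtain ⟨h₀, h₁⟩ := mem_undominatedEdges.1 hi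
  refine ⟨i - 1, ⟨i, Or.inr (cycleGraph_adj.2 (Or.inr (sub_sub_cancel _ _))), h₀, i + 1,
    cycleGraph_adj.2 (Or.inr (add_sub_cancel_left _ _)), h₁⟩, ?_⟩
  have hprev : i - 1 - 1 ∈ X := by
    rw [mem_closedNbhdSet_cycleGraph] at h₀ hi'
    rw [sub_add_cancel] at hi'
    tauto
  have hsub : undominatedEdges X ⊆ insert i (undominatedEdges (insert (i - 1) X)) := by
    intro j hj
    by_cases hji : j = i
    · exact hji ▸ Finset.mem_insert_self _ _
    refine Finset.mem_insert_of_mem ?_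
    rw [mem_undominatedEdges] at hj
    have e₁ : j ≠ i - 1 := fun h => hj.1 (h ▸ hi')
    have e₂ : j - 1 ≠ i - 1 := fun h => hji (sub_left_injective h)
    have e₃ : j + 1 ≠ i - 1 := fun h => hj.2 (h ▸ hi')
    simp only [mem_undominatedEdges, mem_closedNbhdSet_cycleGraph, Set.mem_insert_iff,
      add_sub_cancel_right] at hj ⊢
    have e₄ : j + 1 + 1 ≠ i - 1 := by
      intro h
      rw [← h, add_sub_cancel_right] at hprev
      tauto
    tauto
  exact (Finset.card_le_card hsub).trans (Finset.card_insert_le _ _)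

/-- Staller can increase the number of moves to at least one more than after any given move. -/
theorem isoGameVal_insert_add_one_le_staller [Finite V] {G : SimpleGraph V} {X : Set V} {v : V}
    (k : ℕ) (hv : IsPlayable G X v) :
    isoGameVal G k true (insert v X) + 1 ≤ isoGameVal G (k + 1) false X := by
  rw [isoGameVal, if_pos ⟨v, hv⟩]
  refine le_csSup (Set.Finite.bddAbove ?_) ⟨v, hv, rfl⟩
  refine (Set.finite_range fun v => isoGameVal G k true (insert v X) + 1).subset ?_
  rintro _ ⟨w, -, rfl⟩
  exact ⟨w, rfl⟩

theorem exists_isoGameVal_dominator_eq {G : SimpleGraph V} {X : Set V}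
    (k : ℕ) (h : ∃ v, IsPlayable G X v) :
    ∃ v, IsPlayable G X v ∧
      isoGameVal G (k + 1) true X = isoGameVal G k false (insert v X) + 1 := by
  rw [isoGameVal, if_pos h]
  obtain ⟨v, hv⟩ := h
  exact Nat.sInf_mem (s := {n | ∃ v, IsPlayable G X v ∧
    n = isoGameVal G k false (insert v X) + 1}) ⟨_, v, hv, rfl⟩

/-- Under optimal play Staller's moves destroy one undominated edge each and Dominator's at most
four, which bounds the number of undominated edges in terms of the number of remaining moves. -/
theorem card_undominatedEdges_le_isoGameVal {m : ℕ} (k : ℕ) (X : Set (Fin (m + 2)))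
    (hX : X.Nonempty) (hk : (undominatedEdges X).card ≤ k) :
    (undominatedEdges X).card ≤ 4 * ((isoGameVal (cycleGraph (m + 2)) k true X + 1) / 2) +
        isoGameVal (cycleGraph (m + 2)) k true X / 2 ∧
      (undominatedEdges X).card ≤ 4 * (isoGameVal (cycleGraph (m + 2)) k false X / 2) +
        (isoGameVal (cycleGraph (m + 2)) k false X + 1) / 2 := by
  induction k generalizing X with
  | zero => constructor <;> omega
  | succ k ih =>
    rcases (undominatedEdges X).eq_empty_or_nonempty with hE | hE
    · simp [hE]
    constructor
    · obtain ⟨v, hv, heq⟩ := exists_isoGameVal_dominator_eq k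
        (exists_isPlayable_of_mem_undominatedEdges hE.choose_spec)
      have hlt := card_undominatedEdges_insert_lt hv
      have hle := card_undominatedEdges_le_insert_add_four X v
      have := (ih (insert v X) (Set.insert_nonempty _ _) (by omega)).2
      omega
    · obtain ⟨v, hv, hle⟩ := exists_isPlayable_card_undominatedEdges_le hX hE
      have hval := isoGameVal_insert_add_one_le_staller k hv
      have hlt := card_undominatedEdges_insert_lt hv
      have := (ih (insert v X) (Set.insert_nonempty _ _) (by omega)).1
      omega

/-- Claim A, inequality (2): for `n ≥ 6`,
`min {2⌈(n-3)/5⌉, 2⌈(n-4)/5⌉ + 1} ≤ ι_g'(C_n)`.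
(In ℕ, `⌈m/5⌉ = (m + 4) / 5`.) -/
theorem cycle_stallerStart_game_isolation_lower_bound (n : ℕ) (hn : 6 ≤ n) :
    min (2 * ((n - 3 + 4) / 5)) (2 * ((n - 4 + 4) / 5) + 1) ≤
      iotaGame' (SimpleGraph.cycleGraph n) := by
  obtain ⟨m, rfl⟩ : ∃ m, n = m + 2 := ⟨n - 2, by omega⟩
  have hE : undominatedEdges (∅ : Set (Fin (m + 2))) = Finset.univ := by
    ext i
    simp [mem_undominatedEdges, mem_closedNbhdSet_cycleGraph]
  have hcard : (undominatedEdges (∅ : Set (Fin (m + 2)))).card = m + 2 := by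
    rw [hE, Finset.card_univ, Fintype.card_fin]
  obtain ⟨v, hv⟩ := exists_isPlayable_of_mem_undominatedEdges
    (hE ▸ Finset.mem_univ (0 : Fin (m + 2)))
  have hlt := card_undominatedEdges_insert_lt hv
  have hle := card_undominatedEdges_le_insert_add_four ∅ v
  have hval := isoGameVal_insert_add_one_le_staller (m + 1) hv
  have := (card_undominatedEdges_le_isoGameVal (m + 1) (insert v ∅) (Set.insert_nonempty _ _)
    (by omega)).1
  rw [iotaGame', Fintype.card_fin]
  change _ ≤ isoGameVal _ (m + 1 + 1) _ _
  omega
end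

section
/- For every integer n ≥ 6: if n ≢ 0 (mod 5) then ι_g(C_n) ≤ 2·⌈n/5⌉ − 1, and if n ≡ 0 (mod 5) then ι_g(C_n) ≤ 2·⌈n/5⌉. -/
open SimpleGraph

variable {V : Type*}

/-- The weight of a vertex of a cycle, given which of its left neighbor, itself and its right
neighbor are undominated: interior vertices of a nontrivial undominated arc weigh `1`,
its two ends weigh `2`, and all other vertices weigh `0`. -/
def arcWeight (a b c : Bool) : ℕ :=
  if b then (if a && c then 1 else if a || c then 2 else 0) else 0

/-- The total weight of the undominated vertices on a cycle; every arc of `k ≥ 2` undominated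
vertices between dominated ones contributes `k + 2`. -/
def arcPotential {n : ℕ} [NeZero n] (U : Fin n → Bool) : ℕ :=
  ∑ w, arcWeight (U (w - 1)) (U w) (U (w + 1))

open Classical in
/-- The indicator of the vertices not dominated by `X`. -/
noncomputable def undominated (G : SimpleGraph V) (X : Set V) (v : V) : Bool :=
  decide (v ∉ closedNbhdSet G X)

/-- The total weight of the five inner vertices of a window of seven consecutive ones; selecting
the middle vertex changes no other weights. -/
def windowWeight (x₀ x₁ x₂ x₃ x₄ x₅ x₆ : Bool) : ℕ :=
  arcWeight x₀ x₁ x₂ + arcWeight x₁ x₂ x₃ + arcWeight x₂ x₃ x₄ + arcWeight x₃ x₄ x₅ +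
    arcWeight x₄ x₅ x₆

theorem windowWeight_drop_of_playable (x₀ x₁ x₂ x₃ x₄ x₅ x₆ : Bool)
    (h : (x₂ && (x₁ || x₃)) || (x₃ && (x₂ || x₄)) || (x₄ && (x₃ || x₅))) :
    windowWeight x₀ x₁ false false false x₅ x₆ + 1 ≤ windowWeight x₀ x₁ x₂ x₃ x₄ x₅ x₆ := by
  revert x₀ x₁ x₂ x₃ x₄ x₅ x₆
  decide

theorem windowWeight_drop_of_left_end (x₃ x₄ x₅ x₆ : Bool) :
    windowWeight false true false false false x₅ x₆ + 4 ≤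
      windowWeight false true true x₃ x₄ x₅ x₆ := by
  revert x₃ x₄ x₅ x₆
  decide

open Classical in
theorem undominated_eq_true_iff (G : SimpleGraph V) (X : Set V) (v : V) :
    undominated G X v = true ↔ v ∉ X ∧ ∀ x ∈ X, ¬ G.Adj x v := by
  rw [undominated, decide_eq_true_eq]
  simp [closedNbhdSet]

theorem undominated_insert (G : SimpleGraph V) (X : Set V) (v w : V) :
    undominated G (insert v X) w = true ↔ undominated G X w = true ∧ w ≠ v ∧ ¬ G.Adj v w := by
  simp only [undominated_eq_true_iff, Set.mem_insert_iff, forall_eq_or_imp]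
  tauto

theorem undominated_empty (G : SimpleGraph V) (v : V) : undominated G ∅ v = true := by
  simp [undominated, closedNbhdSet]

theorem isPlayable_iff (G : SimpleGraph V) (X : Set V) (v : V) :
    IsPlayable G X v ↔ ∃ u, (u = v ∨ G.Adj v u) ∧ undominated G X u = true ∧
      ∃ w, G.Adj u w ∧ undominated G X w = true := by
  simp [IsPlayable, undominated]

theorem fin_numerals_ne_zero (m : ℕ) :
    (2 : Fin (m + 6)) ≠ 0 ∧ (3 : Fin (m + 6)) ≠ 0 ∧ (4 : Fin (m + 6)) ≠ 0 := by
  simp [Fin.ext_iff, Nat.mod_eq_of_lt]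

section FinRing

open Fin.CommRing

theorem cycleGraph_adj_iff (m : ℕ) (v w : Fin (m + 6)) :
    (cycleGraph (m + 6)).Adj v w ↔ w = v + 1 ∨ w + 1 = v := by
  rw [SimpleGraph.cycleGraph_adj, sub_eq_iff_eq_add, sub_eq_iff_eq_add]
  constructor <;> rintro (h | h) <;> simp [h, add_comm]

theorem undominated_cycleGraph_insert (m : ℕ) (X : Set (Fin (m + 6))) (b w : Fin (m + 6)) :
    undominated (cycleGraph (m + 6)) (insert (b + 3) X) w =
      if w = b + 2 ∨ w = b + 3 ∨ w = b + 4 then false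
      else undominated (cycleGraph (m + 6)) X w := by
  rw [Bool.eq_iff_iff, undominated_insert, cycleGraph_adj_iff]
  have e₁ : w + 1 = b + 3 ↔ w = b + 2 := by
    constructor <;> intro h <;> grind
  have e₂ : b + 3 + 1 = b + 4 := by ring
  rw [e₁, e₂]
  split_ifs <;> simp <;> tauto

/-- Selecting `b + 3` changes the potential only within the window `b, …, b + 6`. -/
theorem arcPotential_insert (m : ℕ) (X : Set (Fin (m + 6))) (b : Fin (m + 6)) :
    let U := undominated (cycleGraph (m + 6)) X
    ∃ r, arcPotential U =
        r + windowWeight (U b) (U (b + 1)) (U (b + 2)) (U (b + 3)) (U (b + 4)) (U (b + 5))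
          (U (b + 6)) ∧
      arcPotential (undominated (cycleGraph (m + 6)) (insert (b + 3) X)) =
        r + windowWeight (U b) (U (b + 1)) false false false (U (b + 5)) (U (b + 6)) := by
  intro U
  obtain ⟨h₂, h₃, h₄⟩ := fin_numerals_ne_zero m
  set T : Finset (Fin (m + 6)) := {b + 1, b + 2, b + 3, b + 4, b + 5} with hT
  have split (F : Fin (m + 6) → ℕ) : ∑ w, F w = ∑ w ∈ Tᶜ, F w +
      (F (b + 1) + F (b + 2) + F (b + 3) + F (b + 4) + F (b + 5)) := by
    rw [← Finset.sum_compl_add_sum T, hT]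
    iterate 4 rw [Finset.sum_insert (by simp [Fin.ext_iff, Nat.mod_eq_of_lt])]
    rw [Finset.sum_singleton]
    ring
  have s₁ : b + 1 - 1 = b := by ring
  have s₂ : b + 2 - 1 = b + 1 := by ring
  have s₃ : b + 3 - 1 = b + 2 := by ring
  have s₄ : b + 4 - 1 = b + 3 := by ring
  have s₅ : b + 5 - 1 = b + 4 := by ring
  have t₁ : b + 1 + 1 = b + 2 := by ring
  have t₂ : b + 2 + 1 = b + 3 := by ring
  have t₃ : b + 3 + 1 = b + 4 := by ring
  have t₄ : b + 4 + 1 = b + 5 := by ring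
  have t₅ : b + 5 + 1 = b + 6 := by ring
  refine ⟨∑ w ∈ Tᶜ, arcWeight (U (w - 1)) (U w) (U (w + 1)), ?_, ?_⟩
  · rw [arcPotential, split]
    simp only [s₁, s₂, s₃, s₄, s₅, t₁, t₂, t₃, t₄, t₅, windowWeight]
  · rw [arcPotential, split]
    simp only [s₁, s₂, s₃, s₄, s₅, t₁, t₂, t₃, t₄, t₅, windowWeight]
    refine congrArg₂ (· + ·) ?_ ?_
    · refine Finset.sum_congr rfl fun w hw => ?_
      simp only [hT, Finset.mem_compl, Finset.mem_insert, Finset.mem_singleton, not_or] at hw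
      simp only [undominated_cycleGraph_insert]
      rw [if_neg (by grind), if_neg (by grind), if_neg (by grind)]
    · have c₀ : ¬ (b = b + 2 ∨ b = b + 3 ∨ b = b + 4) := by simp [h₂, h₃, h₄]
      have c₁ : ¬ (b + 1 = b + 2 ∨ b + 1 = b + 3 ∨ b + 1 = b + 4) := by
        simp [Fin.ext_iff, Nat.mod_eq_of_lt]
      have c₅ : ¬ (b + 5 = b + 2 ∨ b + 5 = b + 3 ∨ b + 5 = b + 4) := by
        simp [Fin.ext_iff, Nat.mod_eq_of_lt]
      have c₆ : ¬ (b + 6 = b + 2 ∨ b + 6 = b + 3 ∨ b + 6 = b + 4) := by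
        rintro (h | h | h)
        · exact h₄ (by linear_combination h)
        · exact h₃ (by linear_combination h)
        · exact h₂ (by linear_combination h)
      simp only [undominated_cycleGraph_insert, c₀, c₁, c₅, c₆, if_false, true_or, or_true,
        if_true, U]

theorem arcPotential_insert_lt (m : ℕ) (X : Set (Fin (m + 6))) (v : Fin (m + 6))
    (hv : IsPlayable (cycleGraph (m + 6)) X v) :
    arcPotential (undominated (cycleGraph (m + 6)) (insert v X)) + 1 ≤
      arcPotential (undominated (cycleGraph (m + 6)) X) := by
  obtain ⟨b, rfl⟩ : ∃ b, v = b + 3 := ⟨v - 3, by ring⟩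
  obtain ⟨r, h₁, h₂⟩ := arcPotential_insert m X b
  rw [h₁, h₂, add_assoc]
  refine Nat.add_le_add_left (windowWeight_drop_of_playable _ _ _ _ _ _ _ ?_) r
  rw [isPlayable_iff] at hv
  simp only [cycleGraph_adj_iff] at hv
  obtain ⟨u, hu, hUu, w, hw, hUw⟩ := hv
  have hu' : u = b + 2 ∨ u = b + 3 ∨ u = b + 4 := by grind
  simp only [Bool.or_eq_true, Bool.and_eq_true]
  rcases hu' with rfl | rfl | rfl
  · have : w = b + 1 ∨ w = b + 3 := by grind
    rcases this with rfl | rfl <;> tauto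
  · have : w = b + 2 ∨ w = b + 4 := by grind
    rcases this with rfl | rfl <;> tauto
  · have : w = b + 3 ∨ w = b + 5 := by grind
    rcases this with rfl | rfl <;> tauto

/-- If some vertex is dominated and some move is possible, there is a leftmost vertex of a
nontrivial undominated arc. -/
theorem exists_left_end (m : ℕ) (X : Set (Fin (m + 6))) (hX : X.Nonempty)
    (h : ∃ v, IsPlayable (cycleGraph (m + 6)) X v) :
    ∃ b, undominated (cycleGraph (m + 6)) X b = false ∧
      undominated (cycleGraph (m + 6)) X (b + 1) = true ∧
      undominated (cycleGraph (m + 6)) X (b + 2) = true := by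
  set U := undominated (cycleGraph (m + 6)) X
  by_contra! hne
  obtain ⟨p, hp, hp'⟩ : ∃ p, U p = true ∧ U (p + 1) = true := by
    obtain ⟨v, hv⟩ := h
    rw [isPlayable_iff] at hv
    simp only [cycleGraph_adj_iff] at hv
    obtain ⟨u, -, hu, w, rfl | rfl, hw⟩ := hv
    · exact ⟨u, hu, hw⟩
    · exact ⟨w, hw, hu⟩
  have key (k : ℕ) : U (p - (k : Fin (m + 6))) = true ∧ U (p - (k : Fin (m + 6)) + 1) = true := by
    induction k with
    | zero => simpa using ⟨hp, hp'⟩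
    | succ k ih =>
      have e₁ : p - ((k + 1 : ℕ) : Fin (m + 6)) + 1 = p - (k : Fin (m + 6)) := by
        push_cast; ring
      have e₂ : p - ((k + 1 : ℕ) : Fin (m + 6)) + 2 = p - (k : Fin (m + 6)) + 1 := by
        push_cast; ring
      have := hne (p - ((k + 1 : ℕ) : Fin (m + 6)))
      rw [e₁, e₂] at this
      rw [e₁]
      exact ⟨by by_contra h; exact this (by simpa using h) ih.1 ih.2, ih.1⟩
  obtain ⟨x, hx⟩ := hX
  have hx' := (key (p - x).val).1
  rw [Fin.cast_val_eq_self, sub_sub_cancel] at hx'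
  exact ((undominated_eq_true_iff _ _ _).1 hx').1 hx

theorem exists_insert_arcPotential_add_four_le (m : ℕ) (X : Set (Fin (m + 6))) (hX : X.Nonempty)
    (h : ∃ v, IsPlayable (cycleGraph (m + 6)) X v) :
    ∃ v, IsPlayable (cycleGraph (m + 6)) X v ∧
      arcPotential (undominated (cycleGraph (m + 6)) (insert v X)) + 4 ≤
        arcPotential (undominated (cycleGraph (m + 6)) X) := by
  obtain ⟨b, h₀, h₁, h₂⟩ := exists_left_end m X hX h
  refine ⟨b + 3, ?_, ?_⟩
  · rw [isPlayable_iff]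
    simp only [cycleGraph_adj_iff]
    exact ⟨b + 2, by grind, h₂, b + 1, by grind, h₁⟩
  · obtain ⟨r, e₁, e₂⟩ := arcPotential_insert m X b
    rw [e₁, e₂, h₀, h₁, h₂, add_assoc]
    exact Nat.add_le_add_left (windowWeight_drop_of_left_end _ _ _ _) r

end FinRing

theorem isoGameVal_true_succ_le (G : SimpleGraph V) (k : ℕ) (X : Set V) (v : V)
    (hv : IsPlayable G X v) :
    isoGameVal G (k + 1) true X ≤ isoGameVal G k false (insert v X) + 1 := by
  simp only [isoGameVal, if_pos (⟨v, hv⟩ : ∃ v, IsPlayable G X v), if_true]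
  exact Nat.sInf_le ⟨v, hv, rfl⟩

theorem isoGameVal_false_succ_le (G : SimpleGraph V) (k c : ℕ) (X : Set V)
    (h : ∀ v, IsPlayable G X v → isoGameVal G k true (insert v X) + 1 ≤ c) :
    isoGameVal G (k + 1) false X ≤ c := by
  by_cases hp : ∃ v, IsPlayable G X v
  · simp only [isoGameVal, if_pos hp, Bool.false_eq_true, if_false]
    obtain ⟨v, hv⟩ := hp
    refine csSup_le ⟨_, v, hv, rfl⟩ ?_
    rintro _ ⟨w, hw, rfl⟩
    exact h w hw
  · simp [isoGameVal, hp]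

theorem isoGameVal_le_of_arcPotential (m k : ℕ) (X : Set (Fin (m + 6))) (hX : X.Nonempty) :
    let p := arcPotential (undominated (cycleGraph (m + 6)) X)
    isoGameVal (cycleGraph (m + 6)) k false X ≤ p / 5 + (p + 1) / 5 ∧
      isoGameVal (cycleGraph (m + 6)) k true X ≤ (p + 1) / 5 + (p - 3) / 5 := by
  induction k generalizing X with
  | zero => simp [isoGameVal]
  | succ k ih =>
    intro p
    constructor
    · refine isoGameVal_false_succ_le _ _ _ _ fun v hv => ?_
      have hval := (ih (insert v X) (Set.insert_nonempty v X)).2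
      have hdrop := arcPotential_insert_lt m X v hv
      obtain ⟨_, _, hfour⟩ := exists_insert_arcPotential_add_four_le m X hX ⟨v, hv⟩
      omega
    · by_cases hp : ∃ v, IsPlayable (cycleGraph (m + 6)) X v
      · obtain ⟨v, hv, hdrop⟩ := exists_insert_arcPotential_add_four_le m X hX hp
        have hval := (ih (insert v X) (Set.insert_nonempty v X)).1
        have hmove := isoGameVal_true_succ_le _ k X v hv
        omega
      · simp [isoGameVal, hp]

theorem arcPotential_undominated_empty (m : ℕ) :
    arcPotential (undominated (cycleGraph (m + 6)) ∅) = m + 6 := by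
  simp [arcPotential, undominated_empty, arcWeight]

theorem iotaGame_cycleGraph_le (m : ℕ) :
    iotaGame (cycleGraph (m + 6)) ≤ 1 + (m + 5) / 5 + (m + 6) / 5 := by
  have hplay : IsPlayable (cycleGraph (m + 6)) ∅ 0 := by
    rw [isPlayable_iff]
    exact ⟨0, Or.inl rfl, undominated_empty _ _, 1, by simp [cycleGraph_adj_iff],
      undominated_empty _ _⟩
  have hdrop := arcPotential_insert_lt m ∅ 0 hplay
  have hval := (isoGameVal_le_of_arcPotential m (m + 5) (insert 0 ∅)
    (Set.insert_nonempty 0 ∅)).1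
  have hmove : isoGameVal (cycleGraph (m + 6)) (m + 6) true ∅ ≤
      isoGameVal (cycleGraph (m + 6)) (m + 5) false (insert 0 ∅) + 1 :=
    isoGameVal_true_succ_le _ (m + 5) ∅ 0 hplay
  rw [arcPotential_undominated_empty] at hdrop
  rw [iotaGame, Fintype.card_fin]
  omega

/-- Claim B(a): for `n ≥ 6`, if `n ≢ 0 (mod 5)` then `ι_g(C_n) ≤ 2⌈n/5⌉ - 1`, and if
`n ≡ 0 (mod 5)` then `ι_g(C_n) ≤ 2⌈n/5⌉`.  (In ℕ, `⌈n/5⌉ = (n + 4) / 5`.) -/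
theorem cycle_game_isolation_upper_bound (n : ℕ) (hn : 6 ≤ n) :
    (n % 5 ≠ 0 → iotaGame (SimpleGraph.cycleGraph n) ≤ 2 * ((n + 4) / 5) - 1) ∧
    (n % 5 = 0 → iotaGame (SimpleGraph.cycleGraph n) ≤ 2 * ((n + 4) / 5)) := by
  obtain ⟨m, rfl⟩ := Nat.exists_eq_add_of_le' hn
  have := iotaGame_cycleGraph_le m
  omega
end

section
/- For every integer n ≥ 1, the game isolation number of the path P_n satisfies: ι_g(P_n) = ⌊(2n+1)/5⌋ − 1 if n ≡ 0 (mod 5), and ι_g(P_n) = ⌊(2n+1)/5⌋ otherwise. -/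
open SimpleGraph

variable {V : Type*}

section GameValue

variable {G : SimpleGraph V} {X : Set V} {v : V} {k m : ℕ}

lemma notMem_closedNbhdSet_insert {u : V} :
    u ∉ closedNbhdSet G (insert v X) ↔ u ∉ closedNbhdSet G X ∧ u ≠ v ∧ ¬ G.Adj v u := by
  simp only [closedNbhdSet, Set.mem_ofPred_eq, Set.mem_insert_iff]
  grind

lemma isoGameVal_eq_zero (h : ¬ ∃ v, IsPlayable G X v) (b : Bool) :
    isoGameVal G k b X = 0 := by
  cases k <;> simp [isoGameVal, h]

lemma isoGameVal_le_fuel (G : SimpleGraph V) (k : ℕ) (b : Bool) (X : Set V) :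
    isoGameVal G k b X ≤ k := by
  induction k generalizing b X with
  | zero => simp [isoGameVal]
  | succ k ih =>
    by_cases h : ∃ v, IsPlayable G X v
    · obtain ⟨v, hv⟩ := h
      rw [isoGameVal, if_pos ⟨v, hv⟩]
      cases b
      · refine csSup_le ⟨_, v, hv, rfl⟩ ?_
        rintro _ ⟨w, -, rfl⟩
        exact Nat.succ_le_succ (ih _ _)
      · refine le_trans (Nat.sInf_le ⟨v, hv, rfl⟩) (Nat.succ_le_succ (ih _ _))
    · simp [isoGameVal_eq_zero h]

lemma isoGameVal_dominator_le (hv : IsPlayable G X v) :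
    isoGameVal G (k + 1) true X ≤ isoGameVal G k false (insert v X) + 1 := by
  rw [isoGameVal, if_pos ⟨v, hv⟩]
  exact Nat.sInf_le ⟨v, hv, rfl⟩

lemma le_isoGameVal_dominator (hv : IsPlayable G X v)
    (h : ∀ w, IsPlayable G X w → m ≤ isoGameVal G k false (insert w X) + 1) :
    m ≤ isoGameVal G (k + 1) true X := by
  rw [isoGameVal, if_pos ⟨v, hv⟩]
  refine le_csInf ⟨_, v, hv, rfl⟩ ?_
  rintro _ ⟨w, hw, rfl⟩
  exact h w hw

lemma le_isoGameVal_staller (hv : IsPlayable G X v) :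
    isoGameVal G k true (insert v X) + 1 ≤ isoGameVal G (k + 1) false X := by
  rw [isoGameVal, if_pos ⟨v, hv⟩]
  refine le_csSup (bddAbove_def.2 ⟨k + 1, ?_⟩) ⟨v, hv, rfl⟩
  rintro _ ⟨w, -, rfl⟩
  exact Nat.succ_le_succ (isoGameVal_le_fuel _ _ _ _)

lemma isoGameVal_staller_le
    (h : ∀ w, IsPlayable G X w → isoGameVal G k true (insert w X) + 1 ≤ m) :
    isoGameVal G (k + 1) false X ≤ m := by
  by_cases hX : ∃ v, IsPlayable G X v
  · obtain ⟨v, hv⟩ := hX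
    rw [isoGameVal, if_pos ⟨v, hv⟩]
    refine csSup_le ⟨_, v, hv, rfl⟩ ?_
    rintro _ ⟨w, hw, rfl⟩
    exact h w hw
  · simp [isoGameVal_eq_zero hX]

end GameValue

/-- `L` lists, from left to right, half-open intervals (possibly empty), any two of them at
least two apart, whose union is the set of vertices of the path not dominated by `X`. -/
structure IsIntervalDecomp {n : ℕ} (X : Set (Fin n)) (L : List (ℕ × ℕ)) : Prop where
  pairwise : L.Pairwise fun p q => p.2 + 2 ≤ q.1
  le : ∀ p ∈ L, p.2 ≤ n
  notMem_iff : ∀ u : Fin n, u ∉ closedNbhdSet (pathGraph n) X ↔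
    ∃ p ∈ L, p.1 ≤ u.val ∧ u.val < p.2

namespace IsIntervalDecomp

variable {n : ℕ} {X : Set (Fin n)} {L L₁ L₂ : List (ℕ × ℕ)} {s e : ℕ} {v : Fin n}

lemma empty (n : ℕ) : IsIntervalDecomp (∅ : Set (Fin n)) [(0, n)] where
  pairwise := by simp
  le := by simp
  notMem_iff := by simp [closedNbhdSet]

lemma insert_vertex (h : IsIntervalDecomp X (L₁ ++ (s, e) :: L₂))
    (hs : s ≤ v.val + 1) (he : v.val ≤ e) :
    IsIntervalDecomp (insert v X) (L₁ ++ (s, v.val - 1) :: (v.val + 2, e) :: L₂) := by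
  have hp := h.pairwise
  simp only [List.pairwise_append, List.pairwise_cons, List.mem_cons] at hp
  obtain ⟨hp₁, ⟨hp₂, hp₃⟩, hp₄⟩ := hp
  refine ⟨?_, ?_, fun u => ?_⟩
  · simp only [List.pairwise_append, List.pairwise_cons, List.mem_cons]
    refine ⟨hp₁, ⟨?_, hp₂, hp₃⟩, ?_⟩
    · rintro q (rfl | hq)
      · dsimp only; omega
      · have := hp₂ q hq
        omega
    · rintro p hp q (rfl | rfl | hq)
      · exact hp₄ p hp (s, e) (Or.inl rfl)
      · have := hp₄ p hp (s, e) (Or.inl rfl)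
        dsimp only at this ⊢; omega
      · exact hp₄ p hp q (Or.inr hq)
  · have hle := h.le
    simp only [List.mem_append, List.mem_cons] at hle ⊢
    rintro p (hp | rfl | rfl | hp)
    · exact hle p (Or.inl hp)
    · have := v.isLt
      dsimp only; omega
    · exact hle (s, e) (by simp)
    · exact hle p (by simp [hp])
  · rw [notMem_closedNbhdSet_insert, h.notMem_iff, pathGraph_adj, Ne, Fin.ext_iff]
    simp only [List.mem_append, List.mem_cons]
    constructor
    · rintro ⟨⟨p, hp | rfl | hp, hpu⟩, hu⟩
      · exact ⟨p, by simp [hp], hpu⟩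
      · rcases Nat.lt_or_ge u.val v.val with huv | huv
        · exact ⟨(s, v.val - 1), by simp, by dsimp only at hpu ⊢; omega⟩
        · exact ⟨(v.val + 2, e), by simp, by dsimp only at hpu ⊢; omega⟩
      · exact ⟨p, by simp [hp], hpu⟩
    · rintro ⟨p, hp | rfl | rfl | hp, hpu⟩
      · have := hp₄ p hp (s, e) (Or.inl rfl)
        dsimp only at this
        exact ⟨⟨p, by simp [hp], hpu⟩, by omega⟩
      · dsimp only at hpu
        exact ⟨⟨(s, e), by simp, by dsimp only; omega⟩, by omega⟩
      · dsimp only at hpu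
        exact ⟨⟨(s, e), by simp, by dsimp only; omega⟩, by omega⟩
      · have := hp₂ p hp
        exact ⟨⟨p, by simp [hp], hpu⟩, by omega⟩

lemma isPlayable_iff (h : IsIntervalDecomp X L) :
    IsPlayable (pathGraph n) X v ↔
      ∃ p ∈ L, p.1 + 2 ≤ p.2 ∧ p.1 ≤ v.val + 1 ∧ v.val ≤ p.2 := by
  constructor
  · rintro ⟨u, hvu, hu, w, huw, hw⟩
    obtain ⟨p, hp, hpu⟩ := (h.notMem_iff u).1 hu
    obtain ⟨q, hq, hqw⟩ := (h.notMem_iff w).1 hw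
    rw [pathGraph_adj] at huw
    rw [pathGraph_adj, Fin.ext_iff] at hvu
    have hpq : p = q := by
      by_contra hne
      have hsymm : Std.Symm fun a b : ℕ × ℕ => a.2 + 2 ≤ b.1 ∨ b.2 + 2 ≤ a.1 :=
        ⟨fun _ _ => Or.symm⟩
      have := (h.pairwise.imp (S := fun a b => a.2 + 2 ≤ b.1 ∨ b.2 + 2 ≤ a.1)
        Or.inl).forall hp hq hne
      omega
    subst hpq
    exact ⟨p, hp, by omega⟩
  · rintro ⟨⟨s, e⟩, hp, hse, hsv, hve⟩
    dsimp only at hse hsv hve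
    have hen := h.le _ hp
    dsimp only at hen
    obtain ⟨u, w, hun, hwn, hu, hw, hvu, huw⟩ : ∃ u w : ℕ, u < n ∧ w < n ∧
        (s ≤ u ∧ u < e) ∧ (s ≤ w ∧ w < e) ∧
        (u = v.val ∨ v.val + 1 = u ∨ u + 1 = v.val) ∧ (u + 1 = w ∨ w + 1 = u) := by
      rcases Nat.lt_or_ge v.val s with h₁ | h₁
      · exact ⟨s, s + 1, by omega⟩
      · rcases Nat.lt_or_ge (v.val + 1) e with h₂ | h₂
        · exact ⟨v.val, v.val + 1, by omega⟩
        · exact ⟨e - 1, e - 2, by omega⟩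
    refine ⟨⟨u, hun⟩, ?_, (h.notMem_iff _).2 ⟨_, hp, hu⟩, ⟨w, hwn⟩, ?_,
      (h.notMem_iff _).2 ⟨_, hp, hw⟩⟩
    · rw [pathGraph_adj, Fin.ext_iff]; exact hvu
    · rw [pathGraph_adj]; exact huw

end IsIntervalDecomp

/-- The total value of a list of intervals, where an interval of length `l` has value `f l`. -/
def intervalSum (f : ℕ → ℕ) (L : List (ℕ × ℕ)) : ℕ :=
  (L.map fun p => f (p.2 - p.1)).sum

lemma intervalSum_append_cons (f : ℕ → ℕ) (L₁ L₂ : List (ℕ × ℕ)) (s e : ℕ) :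
    intervalSum f (L₁ ++ (s, e) :: L₂) = f (e - s) + intervalSum f (L₁ ++ L₂) := by
  simp only [intervalSum, List.map_append, List.map_cons, List.sum_append, List.sum_cons]
  omega

/-- The Dominator-start game isolation number of a path with `m` edges. -/
def dominatorValue (m : ℕ) : ℕ := 2 * (m / 5) + min (m % 5) 1

/-- The Staller-start value of the game on a path with `m` edges one of whose ends has an
additional dominated neighbor. -/
def stallerValue (m : ℕ) : ℕ := 2 * (m / 5) + min (m % 5) 2

section LowerBound

variable {n : ℕ} {X : Set (Fin n)} {L : List (ℕ × ℕ)}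

/-- Dominator destroys at most four edges between undominated vertices with each move, and
Staller can always destroy just one. -/
lemma min_value_le_isoGameVal (k : ℕ) (h : IsIntervalDecomp X L) :
    min k (dominatorValue (intervalSum (· - 1) L)) ≤ isoGameVal (pathGraph n) k true X ∧
    (X.Nonempty →
      min k (stallerValue (intervalSum (· - 1) L)) ≤ isoGameVal (pathGraph n) k false X) := by
  induction k generalizing X L with
  | zero => simp
  | succ k ih =>
    by_cases hL : ∃ p ∈ L, p.1 + 2 ≤ p.2
    · obtain ⟨⟨s, e⟩, hp, hse⟩ := hL
      dsimp only at hse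
      have hen := h.le _ hp
      dsimp only at hen
      constructor
      · have hv : IsPlayable (pathGraph n) X ⟨s, by omega⟩ :=
          h.isPlayable_iff.2 ⟨_, hp, hse, by dsimp only; omega, by dsimp only; omega⟩
        refine le_isoGameVal_dominator hv fun w hw => ?_
        obtain ⟨⟨a, b⟩, hq, hab, haw, hwb⟩ := h.isPlayable_iff.1 hw
        obtain ⟨L₁, L₂, rfl⟩ := List.append_of_mem hq
        have := (ih (h.insert_vertex haw hwb)).2 ⟨w, Set.mem_insert _ _⟩
        simp only [intervalSum_append_cons, stallerValue, dominatorValue] at this haw hwb hab ⊢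
        omega
      · rintro ⟨x, hx⟩
        obtain ⟨v, hsv, hve, hv⟩ : ∃ v : Fin n, s ≤ v.val + 1 ∧ v.val ≤ e ∧
            (v.val + 1 = s ∨ v.val = e) := by
          rcases Nat.eq_zero_or_pos s with rfl | hs
          · rcases hen.lt_or_eq with he | rfl
            · exact ⟨⟨e, he⟩, by simp⟩
            · exact absurd (Or.inl hx) ((h.notMem_iff x).2 ⟨_, hp, by simp⟩)
          · exact ⟨⟨s - 1, by omega⟩, by dsimp only; omega⟩
        have hplay : IsPlayable (pathGraph n) X v :=
          h.isPlayable_iff.2 ⟨_, hp, hse, hsv, hve⟩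
        refine le_trans ?_ (le_isoGameVal_staller hplay)
        obtain ⟨L₁, L₂, rfl⟩ := List.append_of_mem hp
        have := (ih (h.insert_vertex hsv hve)).1
        simp only [intervalSum_append_cons, stallerValue, dominatorValue] at this ⊢
        omega
    · have h₀ : intervalSum (· - 1) L = 0 := by
        refine List.sum_eq_zero fun x hx => ?_
        obtain ⟨p, hp, rfl⟩ := List.mem_map.1 hx
        have : ¬ p.1 + 2 ≤ p.2 := fun h' => hL ⟨p, hp, h'⟩
        dsimp only
        omega
      simp [h₀, dominatorValue, stallerValue]

end LowerBound

section UpperBound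

variable {n : ℕ} {X : Set (Fin n)} {L L₁ L₂ : List (ℕ × ℕ)} {s e : ℕ}

/-- In an interval of length `l`, Dominator has a move leaving one of length at most `l - 4`,
up to isolated vertices. -/
lemma IsIntervalDecomp.exists_dominator_move
    (h : IsIntervalDecomp X (L₁ ++ (s, e) :: L₂)) (hse : s + 2 ≤ e) :
    ∃ v, IsPlayable (pathGraph n) X v ∧ ∃ L', IsIntervalDecomp (insert v X) L' ∧
      intervalSum (fun l => stallerValue (l - 1)) L' =
        stallerValue (e - s - 4 - 1) +
          intervalSum (fun l => stallerValue (l - 1)) (L₁ ++ L₂) := by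
  have hmem : (s, e) ∈ L₁ ++ (s, e) :: L₂ := by simp
  have hen := h.le _ hmem
  dsimp only at hen
  obtain ⟨v, hsv, hve, hv⟩ : ∃ v : Fin n, s ≤ v.val + 1 ∧ v.val ≤ e ∧
      (v.val = s + 2 ∧ s + 4 ≤ e ∨ v.val = s + 1 ∧ e < s + 4) := by
    rcases Nat.lt_or_ge e (s + 4) with he | he
    · exact ⟨⟨s + 1, by omega⟩, by dsimp only; omega⟩
    · exact ⟨⟨s + 2, by omega⟩, by dsimp only; omega⟩
  refine ⟨v, h.isPlayable_iff.2 ⟨_, hmem, hse, hsv, hve⟩, _, h.insert_vertex hsv hve, ?_⟩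
  simp only [intervalSum_append_cons, stallerValue]
  omega

/-- Dominator answers every move of Staller in the component where it was played, if he can. -/
lemma isoGameVal_staller_le_intervalSum (k : ℕ) (h : IsIntervalDecomp X L) :
    isoGameVal (pathGraph n) k false X ≤ intervalSum (fun l => stallerValue (l - 1)) L := by
  induction k using Nat.strong_induction_on generalizing X L with
  | _ k ih =>
  rcases k with _ | k
  · simp [isoGameVal]
  refine isoGameVal_staller_le fun w hw => ?_
  obtain ⟨⟨s, e⟩, hp, hse, hsw, hwe⟩ := h.isPlayable_iff.1 hw
  obtain ⟨L₁, L₂, rfl⟩ := List.append_of_mem hp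
  dsimp only at hse hsw hwe
  have h' := h.insert_vertex hsw hwe
  rw [intervalSum_append_cons]
  rcases k with _ | k
  · simp only [isoGameVal, stallerValue]
    omega
  have key : ∀ v, IsPlayable (pathGraph n) (insert w X) v →
      ∀ L', IsIntervalDecomp (insert v (insert w X)) L' →
      isoGameVal (pathGraph n) (k + 1) true (insert w X) ≤
        intervalSum (fun l => stallerValue (l - 1)) L' + 1 := fun v hv L' hL' =>
    (isoGameVal_dominator_le hv).trans (Nat.succ_le_succ (ih k (by omega) hL'))
  by_cases hr : w.val + 2 + 2 ≤ e
  · rw [List.append_cons] at h'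
    obtain ⟨v, hv, L', hL', hsum⟩ := h'.exists_dominator_move hr
    have := key v hv L' hL'
    rw [List.append_assoc, List.singleton_append, intervalSum_append_cons] at hsum
    rw [hsum] at this
    simp only [stallerValue] at this ⊢
    omega
  by_cases hl : s + 2 ≤ w.val - 1
  · obtain ⟨v, hv, L', hL', hsum⟩ := h'.exists_dominator_move hl
    have := key v hv L' hL'
    rw [intervalSum_append_cons] at hsum
    rw [hsum] at this
    simp only [stallerValue] at this ⊢
    omega
  have hsum : intervalSum (fun l => stallerValue (l - 1))
      (L₁ ++ (s, w.val - 1) :: (w.val + 2, e) :: L₂) =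
      intervalSum (fun l => stallerValue (l - 1)) (L₁ ++ L₂) := by
    rw [intervalSum_append_cons, intervalSum_append_cons]
    simp only [stallerValue]
    omega
  by_cases hX : ∃ v, IsPlayable (pathGraph n) (insert w X) v
  · obtain ⟨v, hv⟩ := hX
    obtain ⟨⟨a, b⟩, hq, hab, -, -⟩ := h'.isPlayable_iff.1 hv
    obtain ⟨M₁, M₂, hM⟩ := List.append_of_mem hq
    rw [hM] at h' hsum
    obtain ⟨v, hv, L', hL', hsum'⟩ := h'.exists_dominator_move hab
    have := key v hv L' hL'
    rw [intervalSum_append_cons] at hsum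
    rw [hsum'] at this
    rw [← hsum]
    simp only [stallerValue] at this hab ⊢
    omega
  · rw [isoGameVal_eq_zero hX]
    simp only [stallerValue]
    omega

end UpperBound

lemma iotaGame_pathGraph (n : ℕ) :
    iotaGame (pathGraph n) = dominatorValue (n - 1) := by
  rw [iotaGame, Fintype.card_fin]
  have h₀ := IsIntervalDecomp.empty n
  apply le_antisymm
  · rcases n with _ | n
    · simp [isoGameVal]
    rcases n with _ | n
    · rw [isoGameVal_eq_zero]
      · simp
      · rintro ⟨v, hv⟩
        simpa using h₀.isPlayable_iff.1 hv
    · obtain ⟨v, hv, L', hL', hsum⟩ :=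
        IsIntervalDecomp.exists_dominator_move (L₁ := []) h₀ (by omega)
      refine (isoGameVal_dominator_le hv).trans
        ((Nat.succ_le_succ (isoGameVal_staller_le_intervalSum _ hL')).trans ?_)
      rw [hsum]
      simp only [intervalSum, stallerValue, dominatorValue, List.append_nil, List.map_nil,
        List.sum_nil]
      omega
  · have h := (min_value_le_isoGameVal n h₀).1
    simp only [intervalSum, dominatorValue, List.map_cons, List.map_nil, List.sum_cons,
      List.sum_nil] at h ⊢
    omega

/-- Theorem 1.5 (D-game part): for every `n ≥ 1`, `ι_g(P_n) = ⌊(2n+1)/5⌋ - 1` if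
`n ≡ 0 (mod 5)`, and `ι_g(P_n) = ⌊(2n+1)/5⌋` otherwise. -/
theorem game_isolation_number_path (n : ℕ) (hn : 1 ≤ n) :
    iotaGame (SimpleGraph.pathGraph n) =
      if n % 5 = 0 then (2 * n + 1) / 5 - 1 else (2 * n + 1) / 5 := by
  rw [iotaGame_pathGraph, dominatorValue]
  have hr := Nat.mod_lt n (show 0 < 5 by omega)
  interval_cases h : n % 5 <;> simp only [OfNat.ofNat_ne_zero, one_ne_zero, if_true, if_false] <;>
    omega
end
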